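/- arXiv:2011.05187 — 3 statements merged into one kernel-verified Lean document; each statement's English description precedes it below -/
import Mathlib

section
/- For every integer j ≥ 1, every real d > 0, and all reals 2 ≤ P < Q ≤ 2P, one has ∑_{n≥1} a_j(n²; P, Q) · d^{Ω(n)} / n² ≤ δ_{2|j} · (3dj / (P log P))^{j/2}, where δ_{2|j} = 1 if j is even and δ_{2|j} = 0 if j is odd; in particular the left-hand side vanishes for odd j. -/
/-- `aj j P Q n` counts the `j`-tuples `(p₁, …, p_j)` of prime numbers with
`P < pᵢ ≤ Q` for all `i` and `p₁ ⋯ p_j = n`. -/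
noncomputable def aj (j : ℕ) (P Q : ℝ) (n : ℕ) : ℕ :=
  Nat.card {f : Fin j → ℕ //
    (∀ i, (f i).Prime ∧ P < (f i : ℝ) ∧ (f i : ℝ) ≤ Q) ∧ ∏ i, f i = n}

/-- `bigOmega n` is the number of prime factors of `n` counted with multiplicity. -/
def bigOmega (n : ℕ) : ℕ := n.primeFactorsList.length

open Classical in
/-- The reciprocal of `m` if `m` is a perfect square, and `0` otherwise. -/
noncomputable def squareRecip (m : ℕ) : ℝ := if IsSquare m then 1 / (m : ℝ) else 0

/-- The sum of the reciprocals of the products of those `j`-tuples of elements of `S` whose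
product is a perfect square. -/
noncomputable def squareTupleSum (S : Finset ℕ) (j : ℕ) : ℝ :=
  ∑ f : Fin j → S, squareRecip (∏ i, (f i : ℕ))

lemma squareRecip_nonneg (m : ℕ) : 0 ≤ squareRecip m := by
  unfold squareRecip
  split_ifs <;> positivity

lemma squareRecip_sq_mul {p : ℕ} (hp : p ≠ 0) (m : ℕ) :
    squareRecip (p * (p * m)) = 1 / (p : ℝ) ^ 2 * squareRecip m := by
  have hiff : IsSquare (p * (p * m)) ↔ IsSquare m := by
    constructor
    · rintro ⟨r, hr⟩
      have hdvd : p ^ 2 ∣ r ^ 2 := ⟨m, by rw [pow_two, pow_two, ← hr]; ring⟩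
      obtain ⟨s, rfl⟩ := (Nat.pow_dvd_pow_iff two_ne_zero).1 hdvd
      refine ⟨s, Nat.eq_of_mul_eq_mul_left (Nat.pos_of_ne_zero (mul_ne_zero hp hp)) ?_⟩
      linarith
    · rintro ⟨s, rfl⟩
      exact ⟨p * s, by ring⟩
  unfold squareRecip
  simp only [hiff]
  split_ifs
  · push_cast
    field_simp
  · simp

lemma squareTupleSum_nonneg (S : Finset ℕ) (j : ℕ) : 0 ≤ squareTupleSum S j :=
  Finset.sum_nonneg fun _ _ => squareRecip_nonneg _

/-- In a tuple of primes with square product the first entry must reappear. -/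
lemma squareRecip_mul_prod_le {S : Finset ℕ} (hS : ∀ p ∈ S, p.Prime) {j : ℕ} (p : S)
    (g : Fin j → S) :
    squareRecip (p * ∏ i, (g i : ℕ)) ≤
      ∑ i, if g i = p then squareRecip (p * ∏ i, (g i : ℕ)) else 0 := by
  have hterm : ∀ i, 0 ≤ if g i = p then squareRecip (p * ∏ i, (g i : ℕ)) else 0 := by
    intro i
    split_ifs
    · exact squareRecip_nonneg _
    · exact le_rfl
  by_cases hsq : IsSquare ((p : ℕ) * ∏ i, (g i : ℕ))
  · have hpp : (p : ℕ).Prime := hS p p.2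
    have hdvd : (p : ℕ) ∣ ∏ i, (g i : ℕ) := by
      obtain ⟨r, hr⟩ := hsq
      have hpr : (p : ℕ) ∣ r := by
        have h : (p : ℕ) ∣ r * r := ⟨_, hr.symm⟩
        exact (hpp.dvd_mul.1 h).elim id id
      obtain ⟨s, rfl⟩ := hpr
      exact ⟨s * s, Nat.eq_of_mul_eq_mul_left hpp.pos (by rw [hr]; ring)⟩
    obtain ⟨i, -, hi⟩ := (hpp.prime.dvd_finsetProd_iff _).1 hdvd
    have hgi : g i = p :=
      Subtype.ext ((Nat.prime_dvd_prime_iff_eq hpp (hS _ (g i).2)).1 hi).symm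
    calc squareRecip (p * ∏ i, (g i : ℕ))
        = if g i = p then squareRecip (p * ∏ i, (g i : ℕ)) else 0 := by rw [if_pos hgi]
      _ ≤ _ := Finset.single_le_sum (fun i _ => hterm i) (Finset.mem_univ i)
  · calc squareRecip (p * ∏ i, (g i : ℕ)) = 0 := if_neg hsq
      _ ≤ _ := Finset.sum_nonneg fun i _ => hterm i

lemma squareTupleSum_add_two_le {S : Finset ℕ} (hS : ∀ p ∈ S, p.Prime) (j : ℕ) :
    squareTupleSum S (j + 2) ≤
      (j + 1) * (∑ p ∈ S, 1 / (p : ℝ) ^ 2) * squareTupleSum S j := by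
  have hsum (i : Fin (j + 1)) (p : S) :
      (∑ g : Fin (j + 1) → S, if g i = p then squareRecip (p * ∏ i, (g i : ℕ)) else 0) =
        1 / (p : ℝ) ^ 2 * squareTupleSum S j := by
    rw [← (Fin.insertNthEquiv (fun _ => (S : Type)) i).sum_comp, Fintype.sum_prod_type]
    simp only [Fin.insertNthEquiv_apply, Fin.insertNth_apply_same, Fin.prod_univ_succAbove _ i,
      Fin.insertNth_apply_succAbove]
    rw [Finset.sum_eq_single p]
    · simp only [if_true, squareRecip_sq_mul (hS p p.2).ne_zero, squareTupleSum,
        Finset.mul_sum]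
    · intro q _ hq
      simp [hq]
    · simp
  calc squareTupleSum S (j + 2)
      = ∑ p : S, ∑ g : Fin (j + 1) → S, squareRecip (p * ∏ i, (g i : ℕ)) := by
        unfold squareTupleSum
        rw [← (Fin.insertNthEquiv (fun _ => (S : Type)) (0 : Fin (j + 2))).sum_comp,
          Fintype.sum_prod_type]
        simp only [Fin.insertNthEquiv_apply, Fin.insertNth_apply_same,
          Fin.prod_univ_succAbove _ (0 : Fin (j + 2)), Fin.insertNth_apply_succAbove]
    _ ≤ ∑ p : S, ∑ g : Fin (j + 1) → S, ∑ i,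
          if g i = p then squareRecip (p * ∏ i, (g i : ℕ)) else 0 :=
        Finset.sum_le_sum fun p _ => Finset.sum_le_sum fun g _ =>
          squareRecip_mul_prod_le hS p g
    _ = ∑ p : S, ∑ i : Fin (j + 1), 1 / (p : ℝ) ^ 2 * squareTupleSum S j := by
        refine Finset.sum_congr rfl fun p _ => ?_
        rw [Finset.sum_comm]
        exact Finset.sum_congr rfl fun i _ => hsum i p
    _ = (j + 1) * (∑ p ∈ S, 1 / (p : ℝ) ^ 2) * squareTupleSum S j := by
        simp only [Finset.sum_const, Finset.card_univ, Fintype.card_fin, nsmul_eq_mul]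
        rw [← Finset.sum_coe_sort S, ← Finset.mul_sum, ← Finset.sum_mul]
        push_cast
        ring

lemma squareTupleSum_two_mul_le {S : Finset ℕ} (hS : ∀ p ∈ S, p.Prime) {k K : ℕ}
    (hk : k ≤ K) :
    squareTupleSum S (2 * k) ≤ (2 * K * ∑ p ∈ S, 1 / (p : ℝ) ^ 2) ^ k := by
  have hV : 0 ≤ ∑ p ∈ S, 1 / (p : ℝ) ^ 2 := Finset.sum_nonneg fun _ _ => by positivity
  induction k with
  | zero => simp [squareTupleSum, squareRecip]
  | succ k ih =>
    have hkK : ((k : ℝ) + 1) ≤ K := by exact_mod_cast hk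
    calc squareTupleSum S (2 * k + 2)
        ≤ ((2 * k : ℕ) + 1) * (∑ p ∈ S, 1 / (p : ℝ) ^ 2) * squareTupleSum S (2 * k) :=
          squareTupleSum_add_two_le hS _
      _ ≤ (2 * K * ∑ p ∈ S, 1 / (p : ℝ) ^ 2) *
          (2 * K * ∑ p ∈ S, 1 / (p : ℝ) ^ 2) ^ k := by
          refine mul_le_mul ?_ (ih (by omega)) (squareTupleSum_nonneg _ _) (by positivity)
          gcongr
          push_cast
          linarith
      _ = _ := by ring

/-- The primes in `(P, Q]`. -/
noncomputable def primesBetween (P Q : ℝ) : Finset ℕ :=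
  {p ∈ Finset.range (⌊Q⌋₊ + 1) | p.Prime ∧ P < (p : ℝ) ∧ (p : ℝ) ≤ Q}

lemma mem_primesBetween {P Q : ℝ} {p : ℕ} :
    p ∈ primesBetween P Q ↔ p.Prime ∧ P < (p : ℝ) ∧ (p : ℝ) ≤ Q := by
  simp only [primesBetween, Finset.mem_filter, Finset.mem_range, and_iff_right_iff_imp]
  rintro ⟨-, -, h⟩
  exact Nat.lt_succ_of_le (Nat.le_floor h)

lemma sum_primesBetween_inv_sq_le {P Q : ℝ} (hP : 2 ≤ P) (hQ0 : 0 ≤ Q) (hQ : Q ≤ 2 * P) :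
    ∑ p ∈ primesBetween P Q, 1 / (p : ℝ) ^ 2 ≤ 3 / (P * Real.log P) := by
  have hlogP : 0 < Real.log P := Real.log_pos (by linarith)
  have hcard : (primesBetween P Q).card * Real.log P ≤ 3 * P := by
    calc (primesBetween P Q).card * Real.log P
        = ∑ p ∈ primesBetween P Q, Real.log P := by simp
      _ ≤ ∑ p ∈ primesBetween P Q, Real.log p :=
          Finset.sum_le_sum fun p hp =>
            Real.log_le_log (by linarith) (mem_primesBetween.1 hp).2.1.le
      _ ≤ Chebyshev.theta Q := by
          refine Finset.sum_le_sum_of_subset_of_nonneg (fun p hp => ?_) fun p _ _ => ?_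
          · obtain ⟨hpp, -, hpQ⟩ := mem_primesBetween.1 hp
            simp [hpp, hpp.pos, Nat.le_floor hpQ]
          · exact Real.log_natCast_nonneg p
      _ ≤ Real.log 4 * Q := Chebyshev.theta_le_log4_mul_x hQ0
      _ ≤ 3 / 2 * (2 * P) := by
          have h4 : Real.log 4 ≤ 3 / 2 := by
            rw [show (4 : ℝ) = 2 ^ 2 by norm_num, Real.log_pow]
            push_cast
            linarith [Real.log_two_lt_d9]
          gcongr
      _ = 3 * P := by ring
  calc ∑ p ∈ primesBetween P Q, 1 / (p : ℝ) ^ 2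
      ≤ ∑ p ∈ primesBetween P Q, 1 / P ^ 2 := by
        refine Finset.sum_le_sum fun p hp => ?_
        have := (mem_primesBetween.1 hp).2.1.le
        gcongr
    _ = (primesBetween P Q).card * Real.log P / (P ^ 2 * Real.log P) := by
        rw [Finset.sum_const, nsmul_eq_mul]
        field_simp
    _ ≤ 3 * P / (P ^ 2 * Real.log P) := by gcongr
    _ = 3 / (P * Real.log P) := by field_simp

lemma aj_eq_sum (j : ℕ) (P Q : ℝ) (n : ℕ) :
    (aj j P Q n : ℝ) =
      ∑ f : Fin j → primesBetween P Q, if ∏ i, (f i : ℕ) = n then 1 else 0 := by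
  have e : {f : Fin j → ℕ //
      (∀ i, (f i).Prime ∧ P < (f i : ℝ) ∧ (f i : ℝ) ≤ Q) ∧ ∏ i, f i = n} ≃
      {f : Fin j → primesBetween P Q // ∏ i, (f i : ℕ) = n} :=
    { toFun := fun f => ⟨fun i => ⟨f.1 i, mem_primesBetween.2 (f.2.1 i)⟩, f.2.2⟩
      invFun := fun f => ⟨fun i => f.1 i, fun i => mem_primesBetween.1 (f.1 i).2, f.2⟩ }
  rw [aj, Nat.card_congr e, Nat.card_eq_fintype_card, Fintype.card_subtype]
  simp

open ArithmeticFunction in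
lemma two_mul_bigOmega_eq {j n : ℕ} {f : Fin j → ℕ} (hf : ∀ i, (f i).Prime)
    (h : ∏ i, f i = n ^ 2) : 2 * bigOmega n = j := by
  have hperm : (List.ofFn f).Perm (n ^ 2).primeFactorsList :=
    Nat.primeFactorsList_unique (by rw [List.prod_ofFn, h]) (by simpa using hf)
  have hsq : cardFactors (n ^ 2) = 2 * cardFactors n := cardFactors_pow
  rw [cardFactors_apply, cardFactors_apply] at hsq
  rw [bigOmega, ← hsq, ← hperm.length_eq, List.length_ofFn]

lemma aj_sq_eq_zero_of_odd {j : ℕ} (hj : ¬Even j) (P Q : ℝ) (n : ℕ) :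
    aj j P Q (n ^ 2) = 0 := by
  have : IsEmpty {f : Fin j → ℕ //
      (∀ i, (f i).Prime ∧ P < (f i : ℝ) ∧ (f i : ℝ) ≤ Q) ∧ ∏ i, f i = n ^ 2} := by
    refine ⟨fun f => hj ?_⟩
    have hf i := (f.2.1 i).1
    rw [← two_mul_bigOmega_eq hf f.2.2]
    exact even_two_mul _
  exact Nat.card_of_isEmpty

lemma tsum_aj_sq_eq (k : ℕ) (d P Q : ℝ) :
    ∑' n : ℕ, (aj (2 * k) P Q (n ^ 2) : ℝ) * d ^ bigOmega n / (n ^ 2) =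
      d ^ k * squareTupleSum (primesBetween P Q) (2 * k) := by
  have hterm (n : ℕ) : (aj (2 * k) P Q (n ^ 2) : ℝ) * d ^ bigOmega n / (n ^ 2) =
      ∑ f : Fin (2 * k) → primesBetween P Q, if n = (∏ i, (f i : ℕ)).sqrt then
        d ^ k * squareRecip (∏ i, (f i : ℕ)) else 0 := by
    rw [aj_eq_sum, Finset.sum_mul, Finset.sum_div]
    refine Finset.sum_congr rfl fun f _ => ?_
    have hf i := (mem_primesBetween.1 (f i).2).1
    by_cases h : ∏ i, (f i : ℕ) = n ^ 2
    · have hk : bigOmega n = k := by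
        have := two_mul_bigOmega_eq hf h
        omega
      have hr : squareRecip (n ^ 2) = 1 / (n : ℝ) ^ 2 := by
        rw [squareRecip, if_pos ⟨n, pow_two n⟩]
        push_cast
        rfl
      rw [h, if_pos rfl, if_pos (Nat.sqrt_eq' n).symm, hr, hk]
      ring
    · rw [if_neg h]
      split_ifs with hn
      · have hns : ¬IsSquare (∏ i, (f i : ℕ)) := by
          rintro ⟨r, hr⟩
          apply h
          rw [hn, hr, Nat.sqrt_eq, pow_two]
        simp [squareRecip, hns]
      · simp
  simp only [hterm]
  rw [squareTupleSum, Finset.mul_sum]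
  exact (hasSum_sum fun f _ => hasSum_ite_eq _ _).tsum_eq

theorem stmt1 (j : ℕ) (hj : 1 ≤ j) (d : ℝ) (hd : 0 < d) (P Q : ℝ)
    (hP : 2 ≤ P) (hPQ : P < Q) (hQ : Q ≤ 2 * P) :
    ∑' n : ℕ, (aj j P Q (n ^ 2) : ℝ) * d ^ bigOmega n / (n ^ 2) ≤
      (if Even j then (1 : ℝ) else 0) *
        (3 * d * j / (P * Real.log P)) ^ ((j : ℝ) / 2) := by
  split_ifs with hev
  · obtain ⟨k, rfl⟩ := even_iff_exists_two_mul.1 hev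
    have hexp : ((2 * k : ℕ) : ℝ) / 2 = (k : ℝ) := by
      push_cast
      ring
    have hV : 0 ≤ ∑ p ∈ primesBetween P Q, 1 / (p : ℝ) ^ 2 :=
      Finset.sum_nonneg fun _ _ => by positivity
    rw [tsum_aj_sq_eq, one_mul, hexp, Real.rpow_natCast]
    calc d ^ k * squareTupleSum (primesBetween P Q) (2 * k)
        ≤ d ^ k * (2 * k * ∑ p ∈ primesBetween P Q, 1 / (p : ℝ) ^ 2) ^ k := by
          gcongr
          exact squareTupleSum_two_mul_le (fun p hp => (mem_primesBetween.1 hp).1) le_rfl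
      _ ≤ d ^ k * (2 * k * (3 / (P * Real.log P))) ^ k := by
          gcongr
          exact sum_primesBetween_inv_sq_le hP (by linarith) hQ
      _ = (3 * d * (2 * k : ℕ) / (P * Real.log P)) ^ k := by
          rw [← mul_pow]
          push_cast
          ring
  · simp [aj_sq_eq_zero_of_odd hev]
end

section
/- For every integer j ≥ 1, every real d > 0, and all reals 2 ≤ P < Q ≤ 2P, one has ∑_{m squarefree} ∑_{n squarefull, gcd(m,n)=1} a_j(mn; P, Q) · d^{Ω(mn)} / (m² n) ≤ (48 d² j / (P log P))^{j/2} · { 1 + (20 j log P / P)^{j/6} }. -/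
/-- A positive integer is squarefull if every prime dividing it does so to at least
the second power (in particular, `1` is squarefull). -/
def Squarefull (n : ℕ) : Prop := 0 < n ∧ ∀ p : ℕ, p.Prime → p ∣ n → p ^ 2 ∣ n

open Finset in
theorem sum_prod_moment {ι : Type*} [Fintype ι] [DecidableEq ι] (q x : Bool → ℝ) (j : ℕ) :
    ∑ f : Fin j → ι, ∏ p, ∑ b, q b * x b ^ #{i | f i = p} =
      ∑ ω : ι → Bool, (∏ p, q (ω p)) * (∑ p, x (ω p)) ^ j := by
  simp_rw [Fintype.sum_pow, Finset.mul_sum]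
  rw [Finset.sum_comm]
  refine Finset.sum_congr rfl fun f _ => ?_
  rw [Finset.prod_univ_sum, Fintype.piFinset_univ]
  refine Finset.sum_congr rfl fun ω _ => ?_
  rw [Finset.prod_mul_distrib]
  congr 1
  rw [← Finset.prod_fiberwise univ f]
  refine Finset.prod_congr rfl fun p _ => ?_
  rw [Finset.prod_congr rfl (g := fun _ => x (ω p)), Finset.prod_const]
  intro i hi
  rw [(Finset.mem_filter.1 hi).2]

theorem pow_le_factorial_mul_exp_add (y : ℝ) (j : ℕ) :
    y ^ j ≤ j.factorial * (Real.exp y + Real.exp (-y)) := by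
  have h := Real.pow_div_factorial_le_exp |y| (abs_nonneg y) j
  have hj : (0 : ℝ) < j.factorial := by positivity
  rw [div_le_iff₀ hj] at h
  calc y ^ j ≤ |y| ^ j := by rw [← abs_pow]; exact le_abs_self _
    _ ≤ j.factorial * Real.exp |y| := by linarith
    _ ≤ _ := by
      gcongr
      rcases abs_cases y with ⟨h, _⟩ | ⟨h, _⟩ <;> rw [h] <;> linarith [Real.exp_pos y, Real.exp_pos (-y)]

theorem sum_prod_mul_exp {ι : Type*} [Fintype ι] [DecidableEq ι] (q x : Bool → ℝ) (u : ℝ) :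
    ∑ ω : ι → Bool, (∏ p, q (ω p)) * Real.exp (u * ∑ p, x (ω p)) =
      (∑ b, q b * Real.exp (u * x b)) ^ Fintype.card ι := by
  rw [← Finset.card_univ, ← Finset.prod_const, Finset.prod_univ_sum, Fintype.piFinset_univ]
  refine Finset.sum_congr rfl fun ω _ => ?_
  rw [Finset.prod_mul_distrib, Finset.mul_sum, Real.exp_sum]

open Finset in
theorem sum_prod_moment_le {ι : Type*} [Fintype ι] [DecidableEq ι] {q : Bool → ℝ}
    (hq : ∀ b, 0 ≤ q b) (x : Bool → ℝ) (j : ℕ) {u : ℝ} (hu : 0 < u) :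
    ∑ f : Fin j → ι, ∏ p, ∑ b, q b * x b ^ #{i | f i = p} ≤
      j.factorial / u ^ j * ((∑ b, q b * Real.exp (u * x b)) ^ Fintype.card ι +
        (∑ b, q b * Real.exp (-u * x b)) ^ Fintype.card ι) := by
  rw [sum_prod_moment, ← sum_prod_mul_exp, ← sum_prod_mul_exp, ← Finset.sum_add_distrib,
    Finset.mul_sum]
  refine Finset.sum_le_sum fun ω _ => ?_
  have h := pow_le_factorial_mul_exp_add (u * ∑ p, x (ω p)) j
  rw [mul_pow] at h
  rw [← mul_add, mul_left_comm]
  refine mul_le_mul_of_nonneg_left ?_ (Finset.prod_nonneg fun p _ => hq _)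
  rw [div_mul_eq_mul_div, le_div_iff₀ (by positivity), neg_mul]
  linarith

/-- A two-point distribution on `{-1, 2}` with mean `ε` has all higher moments at least `1`. -/
theorem ite_le_two_point_moment {ε : ℝ} (h0 : 0 ≤ ε) (k : ℕ) :
    (if k = 1 then ε else 1) ≤ (1 + ε) / 3 * 2 ^ k + (2 - ε) / 3 * (-1) ^ k := by
  rcases k with _ | _ | k
  · norm_num; linarith
  · norm_num; linarith
  · rw [if_neg (by omega)]
    have h2 : (1 : ℝ) ≤ 2 ^ k := one_le_pow₀ (by norm_num)
    have h3 : (2 : ℝ) ^ (k + 1 + 1) = 4 * 2 ^ k := by ring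
    rw [h3]
    rcases neg_one_pow_eq_or ℝ (k + 1 + 1) with h | h
    · rw [h]; nlinarith
    · rw [h]
      rcases k with _ | k
      · norm_num at h
      · have h2 : (1 : ℝ) ≤ 2 ^ k := one_le_pow₀ (by norm_num)
        rw [pow_succ]; nlinarith

theorem two_point_exp_le {ε u : ℝ} (h0 : 0 ≤ ε) (hu : 0 ≤ u) (hu1 : u ≤ 0.172) :
    (1 + ε) / 3 * Real.exp (u * 2) + (2 - ε) / 3 * Real.exp (u * -1) ≤
        Real.exp (1.15 * (u ^ 2 + ε * u)) ∧
      (1 + ε) / 3 * Real.exp (-u * 2) + (2 - ε) / 3 * Real.exp (-u * -1) ≤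
        Real.exp (1.15 * (u ^ 2 + ε * u)) := by
  have key (x : ℝ) (hx : |x| ≤ 1) : |Real.exp x - (1 + x + x ^ 2 / 2)| ≤ |x| ^ 3 * (2 / 9) := by
    have := Real.exp_bound hx (n := 3) (by norm_num)
    norm_num [Finset.sum_range_succ, Nat.factorial] at this ⊢
    linarith
  have hu3 : u ^ 3 ≤ 0.172 * u ^ 2 := by nlinarith [sq_nonneg u]
  have hu2 : u ^ 2 ≤ 0.172 * u := by nlinarith
  have hE := Real.add_one_le_exp (1.15 * (u ^ 2 + ε * u))
  have a1 := key (u * 2) (by rw [abs_le]; constructor <;> linarith)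
  have a2 := key (u * -1) (by rw [abs_le]; constructor <;> linarith)
  have a3 := key (-u * 2) (by rw [abs_le]; constructor <;> linarith)
  have a4 := key (-u * -1) (by rw [abs_le]; constructor <;> linarith)
  simp only [abs_mul, abs_neg, abs_of_nonneg hu, abs_two, abs_one, mul_one, abs_le] at a1 a2 a3 a4
  have m1 := Real.add_one_le_exp (u * -1)
  have m2 : Real.exp (-u * 2) ≤ Real.exp (-u * -1) := Real.exp_le_exp.2 (by linarith)
  have e1 : Real.exp (u * 2) - Real.exp (u * -1) ≤ 3 * 1.15 * u := by nlinarith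
  have e2 := mul_le_mul_of_nonneg_left e1 h0
  have e3 := mul_le_mul_of_nonneg_left m2 h0
  constructor
  · nlinarith
  · nlinarith [mul_nonneg h0 hu]

noncomputable section

/-- The finite set of primes in `(P, Q]`. -/
def primesIoc (P Q : ℝ) : Finset ℕ := {p ∈ Finset.range (⌊Q⌋₊ + 1) | p.Prime ∧ P < (p : ℝ)}

theorem mem_primesIoc {P Q : ℝ} (hQ : 0 ≤ Q) {p : ℕ} :
    p ∈ primesIoc P Q ↔ p.Prime ∧ P < (p : ℝ) ∧ (p : ℝ) ≤ Q := by
  rw [primesIoc, Finset.mem_filter, Finset.mem_range, Nat.lt_succ_iff, Nat.le_floor_iff hQ]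
  tauto

theorem card_primesIoc_mul_log_le {P Q : ℝ} (hP : 2 ≤ P) (hPQ : P < Q) (hQ : Q ≤ 2 * P) :
    ((primesIoc P Q).card : ℝ) * Real.log P ≤ 2.8 * P := by
  have hQ0 : 0 ≤ Q := by linarith
  have h1 : P ^ (primesIoc P Q).card ≤ ((primorial ⌊Q⌋₊ : ℕ) : ℝ) := by
    calc P ^ (primesIoc P Q).card = ∏ p ∈ primesIoc P Q, P := by rw [Finset.prod_const]
      _ ≤ ∏ p ∈ primesIoc P Q, (p : ℝ) :=
        Finset.prod_le_prod (fun _ _ => by linarith) fun p hp => ((mem_primesIoc hQ0).1 hp).2.1.le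
      _ = ((∏ p ∈ primesIoc P Q, p : ℕ) : ℝ) := by push_cast; rfl
      _ ≤ _ := by
        rw [Nat.cast_le]
        refine Finset.prod_le_prod_of_subset_of_one_le' ?_ ?_
        · intro p hp
          rw [primesIoc, Finset.mem_filter] at hp
          exact Finset.mem_filter.2 ⟨hp.1, hp.2.1⟩
        · intro p hp _
          exact (Finset.mem_filter.1 hp).2.one_lt.le
  have h2 : ((primorial ⌊Q⌋₊ : ℕ) : ℝ) ≤ 4 ^ ⌊Q⌋₊ := by exact_mod_cast primorial_le_four_pow _
  have h3 := Real.log_le_log (by positivity) (h1.trans h2)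
  rw [Real.log_pow, Real.log_pow, show (4 : ℝ) = 2 ^ 2 by norm_num, Real.log_pow] at h3
  have h4 := Nat.floor_le hQ0
  have h5 := Real.log_two_lt_d9
  push_cast at h3
  nlinarith [Real.log_two_gt_d9]

/-- The `P`-normalised weight of a tuple: each element of `s` hit exactly once costs `1 / P`. -/
def tupleWeight {s : Finset ℕ} {j : ℕ} (P : ℝ) (f : Fin j → s) : ℝ :=
  (∏ p, if Finset.card {i | f i = p} = 1 then 1 / P else 1) / P ^ j

theorem tupleWeight_nonneg {s : Finset ℕ} {j : ℕ} {P : ℝ} (hP : 0 ≤ P) (f : Fin j → s) :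
    0 ≤ tupleWeight P f := by
  unfold tupleWeight
  refine div_nonneg (Finset.prod_nonneg fun p _ => ?_) (by positivity)
  split_ifs <;> positivity

theorem sum_tupleWeight_le_trivial (s : Finset ℕ) (j : ℕ) {P : ℝ} (hP : 1 ≤ P) :
    ∑ f : Fin j → s, tupleWeight P f ≤ (s.card / P) ^ j := by
  have h (f : Fin j → s) : tupleWeight P f ≤ 1 / P ^ j := by
    unfold tupleWeight
    gcongr
    refine Finset.prod_le_one (fun p _ => ?_) fun p _ => ?_
    · split_ifs <;> positivity
    · split_ifs
      · rw [div_le_one (by positivity)]; exact hP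
      · exact le_rfl
  refine (Finset.sum_le_sum fun f _ => h f).trans_eq ?_
  simp [mul_pow, div_eq_mul_inv]

theorem sum_tupleWeight_one (s : Finset ℕ) (P : ℝ) :
    ∑ f : Fin 1 → s, tupleWeight P f = s.card / P ^ 2 := by
  have h (f : Fin 1 → s) : tupleWeight P f = 1 / P ^ 2 := by
    unfold tupleWeight
    rw [Finset.prod_eq_single (f 0)]
    · simp [Finset.filter_true_of_mem, pow_two, div_eq_mul_inv]
    · intro p _ hp
      simp [Finset.filter_singleton, hp.symm]
    · simp
  simp [h, div_eq_mul_inv]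

theorem sum_tupleWeight_le (s : Finset ℕ) (j : ℕ) {P u : ℝ} (hP : 1 ≤ P) (hu : 0 < u)
    (hu1 : u ≤ 0.172) :
    ∑ f : Fin j → s, tupleWeight P f ≤
      2 * j.factorial / (u * P) ^ j * Real.exp (s.card * (1.15 * (u ^ 2 + u / P))) := by
  have h0 : (0 : ℝ) ≤ 1 / P := by positivity
  have h1 : 1 / P ≤ 1 := by rw [div_le_one (by positivity)]; exact hP
  let q : Bool → ℝ := fun b => if b then (1 + 1 / P) / 3 else (2 - 1 / P) / 3
  let x : Bool → ℝ := fun b => if b then 2 else -1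
  have hq : ∀ b, 0 ≤ q b := by
    intro b
    cases b
    · change 0 ≤ (2 - 1 / P) / 3
      linarith
    · change 0 ≤ (1 + 1 / P) / 3
      linarith
  have hm := sum_prod_moment_le (ι := s) hq x j hu
  obtain ⟨e1, e2⟩ := two_point_exp_le h0 hu.le hu1
  simp only [Fintype.sum_bool, Fintype.card_coe, q, x, if_true, Bool.false_eq_true, if_false] at hm
  have hn1 : 0 ≤ (2 - 1 / P) / 3 := by linarith
  have g1 := pow_le_pow_left₀ (by positivity) e1 s.card
  have g2 := pow_le_pow_left₀ (by positivity) e2 s.card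
  rw [← Real.exp_nat_mul, one_div_mul_eq_div] at g1 g2
  unfold tupleWeight
  rw [← Finset.sum_div, div_le_iff₀ (by positivity)]
  calc _ ≤ _ := Finset.sum_le_sum fun f _ => Finset.prod_le_prod (fun p _ => by
          split_ifs <;> positivity) fun p _ => ite_le_two_point_moment h0 _
    _ ≤ _ := hm
    _ ≤ j.factorial / u ^ j * (Real.exp (s.card * (1.15 * (u ^ 2 + u / P))) +
          Real.exp (s.card * (1.15 * (u ^ 2 + u / P)))) := by gcongr
    _ = _ := by rw [mul_pow]; field_simp; ring

theorem two_mul_factorial_le_pow_self {j : ℕ} (hj : 2 ≤ j) : 2 * j.factorial ≤ j ^ j := by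
  induction j, hj using Nat.le_induction with
  | base => decide
  | succ n hn ih =>
    calc 2 * (n + 1).factorial = (n + 1) * (2 * n.factorial) := by rw [Nat.factorial_succ]; ring
      _ ≤ (n + 1) * n ^ n := by gcongr
      _ ≤ (n + 1) * (n + 1) ^ n := by gcongr; omega
      _ = _ := by ring

/-- Every tuple sum is a `j`-th power bounded by the main term of the theorem. -/
theorem exists_sum_tupleWeight_le {j : ℕ} (hj : 1 ≤ j) {P Q : ℝ} (hP : 2 ≤ P) (hPQ : P < Q)
    (hQ : Q ≤ 2 * P) :
    ∃ B : ℝ, 0 ≤ B ∧ B ^ 2 ≤ 48 * j / (P * Real.log P) ∧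
      ∑ f : Fin j → primesIoc P Q, tupleWeight P f ≤ B ^ j := by
  have hlog2 := Real.log_two_gt_d9
  have hlog : 0.693 ≤ Real.log P := by
    have := Real.log_le_log (by norm_num) hP
    linarith
  have hlog0 : 0 < Real.log P := by linarith
  have hP0 : 0 < P := by linarith
  have hN := card_primesIoc_mul_log_le hP hPQ hQ
  set N : ℝ := ((primesIoc P Q).card : ℝ)
  have hN0 : 0 ≤ N := by positivity
  obtain ⟨M, hM⟩ : ∃ M, M = 2.8 * P / Real.log P := ⟨_, rfl⟩
  have hM0 : 0 < M := by rw [hM]; positivity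
  have hNM : N ≤ M := by rw [hM, le_div_iff₀ hlog0]; exact hN
  have hMP : M ≤ 4.05 * P := by rw [hM, div_le_iff₀ hlog0]; nlinarith
  have hj1 : (1 : ℝ) ≤ j := by exact_mod_cast hj
  have hden : 48 * (j : ℝ) / (P * Real.log P) = 48 / 2.8 * j * M / P ^ 2 := by
    rw [hM]; field_simp
  rw [hden]
  rcases le_or_gt M (17 * j) with hA | hA
  · refine ⟨N / P, by positivity, ?_, sum_tupleWeight_le_trivial _ j (by linarith)⟩
    rw [div_pow]
    gcongr
    nlinarith
  rcases hj.eq_or_lt with rfl | hj2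
  · refine ⟨N / P ^ 2, by positivity, ?_, by rw [sum_tupleWeight_one, pow_one]⟩
    rw [div_pow, div_le_div_iff₀ (by positivity) (by positivity)]
    have h1 : N ^ 2 ≤ 4.05 * P * M := by nlinarith
    have h2 : 4.05 * P * M ≤ 48 / 2.8 * M * P ^ 2 := by
      have : 4.05 * P ≤ 48 / 2.8 * P ^ 2 := by nlinarith
      nlinarith
    push_cast
    nlinarith [pow_pos hP0 2]
  have hj2' : (2 : ℝ) ≤ j := by exact_mod_cast hj2
  obtain ⟨u, hu⟩ : ∃ u, u = √(j / (2 * M)) := ⟨_, rfl⟩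
  have hu0 : 0 < u := by rw [hu]; positivity
  have husq : u ^ 2 = j / (2 * M) := by rw [hu, Real.sq_sqrt (by positivity)]
  have hu1 : u ≤ 0.172 := by
    refine (pow_le_pow_iff_left₀ (by positivity) (by norm_num) two_ne_zero).1 ?_
    rw [husq, div_le_iff₀ (by positivity)]
    nlinarith
  refine ⟨Real.exp 1 * j / (u * P), by positivity, ?_, ?_⟩
  · have he : Real.exp 1 ^ 2 ≤ 48 / 5.6 := by
      nlinarith [Real.exp_one_lt_d9, Real.exp_pos 1]
    have : (Real.exp 1 * j / (u * P)) ^ 2 = Real.exp 1 ^ 2 * (2 * j * M / P ^ 2) := by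
      rw [div_pow, mul_pow, mul_pow, husq]; field_simp
    rw [this]
    calc _ ≤ 48 / 5.6 * (2 * j * M / P ^ 2) := by gcongr
      _ = _ := by ring
  · have hfac : (2 * j.factorial : ℝ) ≤ (j : ℝ) ^ j := by
      exact_mod_cast two_mul_factorial_le_pow_self hj2
    have hMu : M * u ^ 2 = j / 2 := by rw [husq]; field_simp
    have hv : M * (u / P) ≤ 0.35 * j := by
      refine (pow_le_pow_iff_left₀ (by positivity) (by positivity) two_ne_zero).1 ?_
      have : (M * (u / P)) ^ 2 = j * M / (2 * P ^ 2) := by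
        rw [mul_pow, div_pow, husq]; field_simp
      rw [this, div_le_iff₀ (by positivity)]
      have h34 : 34 ≤ M := by linarith
      have h2 : M * M ≤ 4.05 * P * (4.05 * P) := by gcongr
      have h3 : M ≤ 0.49 * P ^ 2 := by
        have := mul_le_mul_of_nonneg_right h34 hM0.le
        have := sq_nonneg P
        linarith
      have h4 : (j : ℝ) * M ≤ j * (0.49 * P ^ 2) := by gcongr
      have h5 : 2 * (j * P ^ 2) ≤ j * (j * P ^ 2) := by gcongr
      linarith
    calc _ ≤ _ := sum_tupleWeight_le _ j (by linarith) hu0 hu1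
      _ ≤ (j : ℝ) ^ j / (u * P) ^ j * Real.exp j := by
        gcongr
        change N * (1.15 * (u ^ 2 + u / P)) ≤ (j : ℝ)
        calc N * (1.15 * (u ^ 2 + u / P)) ≤ M * (1.15 * (u ^ 2 + u / P)) := by gcongr
          _ ≤ (j : ℝ) := by nlinarith [hMu, hv]
      _ = _ := by
        rw [div_pow, mul_pow (Real.exp 1), ← Real.exp_nat_mul, mul_one]; ring

theorem factorization_prod_tuple {s : Finset ℕ} (hs : ∀ p ∈ s, p.Prime) {j : ℕ} (f : Fin j → s)
    (p : ℕ) :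
    (∏ i, (f i : ℕ)).factorization p = Finset.card {i | (f i : ℕ) = p} := by
  rw [Nat.factorization_prod fun i _ => (hs _ (f i).2).ne_zero, Finset.card_filter]
  simp only [Finsupp.coe_finsetSum, Finset.sum_apply]
  refine Finset.sum_congr rfl fun i _ => ?_
  rw [(hs _ (f i).2).factorization, Finsupp.single_apply]

/-- The product of those elements of `s` that occur exactly once in the tuple. -/
def simplePart {s : Finset ℕ} {j : ℕ} (f : Fin j → s) : ℕ :=
  ∏ p ∈ s, if Finset.card {i | (f i : ℕ) = p} = 1 then p else 1

theorem eq_simplePart {s : Finset ℕ} (hs : ∀ p ∈ s, p.Prime) {j : ℕ} (f : Fin j → s) {m n : ℕ}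
    (hm : Squarefree m) (hn : Squarefull n) (hmn : m.Coprime n) (h : ∏ i, (f i : ℕ) = m * n) :
    m = simplePart f := by
  have hfac (p : ℕ) : m.factorization p + n.factorization p =
      Finset.card {i | (f i : ℕ) = p} := by
    rw [← factorization_prod_tuple hs, h, Nat.factorization_mul hm.ne_zero hn.1.ne']; rfl
  have key (p : ℕ) (hp : p.Prime) : p ∣ m ↔ Finset.card {i | (f i : ℕ) = p} = 1 := by
    rw [← hfac]
    constructor
    · intro hpm
      have h1 := (hp.dvd_iff_one_le_factorization hm.ne_zero).1 hpm
      have h2 := hm.natFactorization_le_one p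
      have h3 : ¬ p ∣ n := fun hpn => hp.one_lt.ne' (Nat.eq_one_of_dvd_coprimes hmn hpm hpn)
      rw [Nat.factorization_eq_zero_of_not_dvd h3]
      lia
    · intro h1
      by_contra hpm
      rw [Nat.factorization_eq_zero_of_not_dvd hpm] at h1
      have hpn := (hp.dvd_iff_one_le_factorization hn.1.ne').2 (by omega)
      have := (hp.pow_dvd_iff_le_factorization hn.1.ne').1 (hn.2 p hp hpn)
      omega
  conv_lhs => rw [← Nat.prod_primeFactors_of_squarefree hm]
  unfold simplePart
  rw [← Finset.prod_filter]
  refine Finset.prod_congr ?_ fun _ _ => rfl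
  ext p
  rw [Nat.mem_primeFactors_of_ne_zero hm.ne_zero, Finset.mem_filter]
  constructor
  · rintro ⟨hp, hpm⟩
    have hc := (key p hp).1 hpm
    obtain ⟨i, hi⟩ := Finset.card_pos.1 (hc.symm ▸ one_pos)
    exact ⟨(Finset.mem_filter.1 hi).2 ▸ (f i).2, hc⟩
  · rintro ⟨hp, hc⟩
    exact ⟨hs p hp, (key p (hs p hp)).2 hc⟩

theorem inv_simplePart_mul_prod_le {s : Finset ℕ} {j : ℕ} {P : ℝ} (hP : 0 < P)
    (hs : ∀ p ∈ s, P ≤ (p : ℝ)) (f : Fin j → s) :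
    ((simplePart f : ℝ) * ((∏ i, (f i : ℕ) : ℕ) : ℝ))⁻¹ ≤ tupleWeight P f := by
  have h1 : P ^ j ≤ ((∏ i, (f i : ℕ) : ℕ) : ℝ) := by
    push_cast
    calc P ^ j = ∏ _i : Fin j, P := by simp
      _ ≤ _ := Finset.prod_le_prod (fun _ _ => hP.le) fun i _ => hs _ (f i).2
  have h2 : (∏ p : s, if Finset.card {i | f i = p} = 1 then P else 1) ≤ (simplePart f : ℝ) := by
    unfold simplePart
    rw [← Finset.prod_coe_sort s, Nat.cast_prod]
    simp only [Nat.cast_ite, Nat.cast_one]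
    refine Finset.prod_le_prod (fun p _ => ?_) fun p _ => ?_
    · split_ifs <;> positivity
    · simp only [Subtype.ext_iff]
      split_ifs
      · exact hs p p.2
      · exact le_rfl
  have h3 : 0 < ∏ p : s, if Finset.card {i | f i = p} = 1 then P else 1 :=
    Finset.prod_pos fun p _ => by split_ifs <;> positivity
  have h4 : tupleWeight P f =
      ((∏ p : s, if Finset.card {i | f i = p} = 1 then P else 1) * P ^ j)⁻¹ := by
    unfold tupleWeight
    rw [mul_inv, ← Finset.prod_inv_distrib, div_eq_mul_inv]
    congr 1
    refine Finset.prod_congr rfl fun p _ => ?_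
    split_ifs <;> simp
  rw [h4]
  gcongr

theorem aj_le_card {j : ℕ} {P Q : ℝ} (hQ : 0 ≤ Q) (n : ℕ) :
    aj j P Q n ≤ Finset.card {f : Fin j → primesIoc P Q | ∏ i, (f i : ℕ) = n} := by
  rw [← Fintype.card_subtype, ← Nat.card_eq_fintype_card]
  refine Nat.card_le_card_of_injective
    (fun f => ⟨fun i => ⟨f.1 i, (mem_primesIoc hQ).2 (f.2.1 i)⟩, f.2.2⟩) fun f g h => ?_
  ext i
  simpa using congrArg (fun x => (x.1 i : ℕ)) h

theorem bigOmega_prod_tuple {s : Finset ℕ} (hs : ∀ p ∈ s, p.Prime) {j : ℕ} (f : Fin j → s) :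
    bigOmega (∏ i, (f i : ℕ)) = j := by
  have h : ArithmeticFunction.cardFactors (∏ i, (f i : ℕ)) = j := by
    induction j with
    | zero => simp
    | succ j ih =>
      rw [Fin.prod_univ_succ, ArithmeticFunction.cardFactors_mul (hs _ (f 0).2).ne_zero
        (Finset.prod_ne_zero_iff.2 fun i _ => (hs _ (f i.succ).2).ne_zero),
        ArithmeticFunction.cardFactors_apply_prime (hs _ (f 0).2), ih fun i => f i.succ, add_comm]
  exact h

open Classical in
theorem tsum_le_sum_tupleWeight (j : ℕ) {d P Q : ℝ} (hd : 0 < d) (hP : 0 < P) (hQ : 0 ≤ Q) :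
    ∑' mn : ℕ × ℕ,
        (if Squarefree mn.1 ∧ Squarefull mn.2 ∧ Nat.Coprime mn.1 mn.2 then
          (aj j P Q (mn.1 * mn.2) : ℝ) * d ^ bigOmega (mn.1 * mn.2) /
            ((mn.1 : ℝ) ^ 2 * mn.2)
        else 0) ≤
      d ^ j * ∑ f : Fin j → primesIoc P Q, tupleWeight P f := by
  have hs : ∀ p ∈ primesIoc P Q, p.Prime := fun p hp => ((mem_primesIoc hQ).1 hp).1
  have hs' : ∀ p ∈ primesIoc P Q, P ≤ (p : ℝ) := fun p hp => ((mem_primesIoc hQ).1 hp).2.1.le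
  let g (f : Fin j → primesIoc P Q) : ℕ × ℕ :=
    (simplePart f, (∏ i, (f i : ℕ)) / simplePart f)
  have hsum : HasSum (fun mn : ℕ × ℕ => ∑ f : Fin j → primesIoc P Q,
      if mn = g f then d ^ j * tupleWeight P f else 0)
      (∑ f : Fin j → primesIoc P Q, d ^ j * tupleWeight P f) :=
    hasSum_sum fun f _ => hasSum_ite_eq (g f) _
  rw [Finset.mul_sum, ← hsum.tsum_eq]
  have hw (f : Fin j → primesIoc P Q) := tupleWeight_nonneg hP.le f
  have hle (mn : ℕ × ℕ) :
      (if Squarefree mn.1 ∧ Squarefull mn.2 ∧ Nat.Coprime mn.1 mn.2 then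
        (aj j P Q (mn.1 * mn.2) : ℝ) * d ^ bigOmega (mn.1 * mn.2) / ((mn.1 : ℝ) ^ 2 * mn.2)
        else 0) ≤
      ∑ f : Fin j → primesIoc P Q, if mn = g f then d ^ j * tupleWeight P f else 0 := by
    obtain ⟨m, n⟩ := mn
    split_ifs with h
    · obtain ⟨hm, hn, hmn⟩ := h
      calc _ ≤ ((Finset.card {f : Fin j → primesIoc P Q | ∏ i, (f i : ℕ) = m * n} : ℕ) : ℝ) *
              d ^ bigOmega (m * n) / ((m : ℝ) ^ 2 * n) := by
            gcongr
            exact aj_le_card hQ _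
        _ = ∑ f : Fin j → primesIoc P Q, if ∏ i, (f i : ℕ) = m * n then
              d ^ bigOmega (m * n) / ((m : ℝ) ^ 2 * n) else 0 := by
            rw [← Finset.sum_filter, Finset.sum_const, nsmul_eq_mul, mul_div_assoc]
        _ ≤ _ := by
            refine Finset.sum_le_sum fun f _ => ?_
            by_cases hf : ∏ i, (f i : ℕ) = m * n
            · have hms := eq_simplePart hs f hm hn hmn hf
              have hg : (m, n) = g f := by
                simp only [g, ← hms, hf, Nat.mul_div_cancel_left n hm.ne_zero.bot_lt]
              have hwf := inv_simplePart_mul_prod_le hP hs' f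
              rw [if_pos hf, if_pos hg, ← hf, bigOmega_prod_tuple hs, div_eq_mul_inv]
              gcongr
              refine (le_of_eq ?_).trans hwf
              rw [← hms, hf]
              push_cast
              ring
            · rw [if_neg hf]
              split_ifs
              · exact mul_nonneg (by positivity) (hw f)
              · exact le_rfl
    · refine Finset.sum_nonneg fun f _ => ?_
      split_ifs
      · exact mul_nonneg (by positivity) (hw f)
      · exact le_rfl
  refine Summable.tsum_le_tsum hle (hsum.summable.of_nonneg_of_le (fun mn => ?_) hle) hsum.summable
  split_ifs <;> positivity

end

open Classical in
theorem stmt3 (j : ℕ) (hj : 1 ≤ j) (d : ℝ) (hd : 0 < d) (P Q : ℝ)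
    (hP : 2 ≤ P) (hPQ : P < Q) (hQ : Q ≤ 2 * P) :
    ∑' mn : ℕ × ℕ,
        (if Squarefree mn.1 ∧ Squarefull mn.2 ∧ Nat.Coprime mn.1 mn.2 then
          (aj j P Q (mn.1 * mn.2) : ℝ) * d ^ bigOmega (mn.1 * mn.2) /
            ((mn.1 : ℝ) ^ 2 * mn.2)
        else 0) ≤
      (48 * d ^ 2 * j / (P * Real.log P)) ^ ((j : ℝ) / 2) *
        (1 + (20 * j * Real.log P / P) ^ ((j : ℝ) / 6)) := by
  have hlog : 0 < Real.log P := Real.log_pos (by linarith)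
  obtain ⟨B, hB0, hB, hsum⟩ := exists_sum_tupleWeight_le hj hP hPQ hQ
  calc _ ≤ d ^ j * ∑ f : Fin j → primesIoc P Q, tupleWeight P f :=
        tsum_le_sum_tupleWeight j hd (by linarith) (by linarith)
    _ ≤ d ^ j * B ^ j := by gcongr
    _ = ((d * B) ^ 2) ^ ((j : ℝ) / 2) := by
      rw [← Real.rpow_natCast (d * B) 2, ← Real.rpow_mul (by positivity), Nat.cast_ofNat,
        mul_div_cancel₀ _ two_ne_zero, Real.rpow_natCast, mul_pow]
    _ ≤ (48 * d ^ 2 * j / (P * Real.log P)) ^ ((j : ℝ) / 2) := by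
      gcongr
      calc (d * B) ^ 2 = d ^ 2 * B ^ 2 := by ring
        _ ≤ d ^ 2 * (48 * j / (P * Real.log P)) := by gcongr
        _ = _ := by ring
    _ ≤ _ := le_mul_of_one_le_right (by positivity) (le_add_of_nonneg_right (by positivity))
end

section
/- Let n ≥ 2 and κ ∈ ℕ₀^{n−1}. With λ_i = Σ_{l=1}^{n−i} (κ_l + 1) for 1 ≤ i ≤ n−1 and λ_n = 0, one has ∏_{1≤i<j≤n} (λ_i − λ_j)/(j − i) ≤ (1 + |κ|)^{n²−n}, where |κ| = Σ_{j=1}^{n−1} κ_j. (The left-hand side equals the value S_κ(1, …, 1) of the degenerate Schur polynomial at the all-ones point.) -/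
/-- For `κ = (κ₁, …, κ_{n-1})`, `lam n κ i` (with `i : Fin n` zero-based, corresponding
to the paper's index `i+1`) is `λ_{i+1} = Σ_{l=1}^{n-(i+1)} (κ_l + 1)`. -/
def lam (n : ℕ) (κ : Fin (n - 1) → ℕ) (i : Fin n) : ℕ :=
  ∑ l ∈ Finset.univ.filter (fun l : Fin (n - 1) => (l : ℕ) < n - 1 - (i : ℕ)), (κ l + 1)

theorem lam_eq_add_sum (n : ℕ) (κ : Fin (n - 1) → ℕ) (i : Fin n) :
    lam n κ i = (n - 1 - (i : ℕ)) +
      ∑ l ∈ Finset.univ.filter (fun l : Fin (n - 1) => (l : ℕ) < n - 1 - (i : ℕ)), κ l := by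
  rw [lam, Finset.sum_add_distrib, Finset.sum_const, Fin.card_filter_val_lt, smul_eq_mul,
    mul_one, add_comm, min_eq_right (Nat.sub_le _ _)]

theorem lam_antitone (n : ℕ) (κ : Fin (n - 1) → ℕ) : Antitone (lam n κ) := by
  intro i j hij
  refine Finset.sum_le_sum_of_subset fun l hl => ?_
  simp only [Finset.mem_filter, Finset.mem_univ, true_and] at hl ⊢
  have : (i : ℕ) ≤ j := hij
  omega

theorem lam_le_lam_add (n : ℕ) (κ : Fin (n - 1) → ℕ) {i j : Fin n} (hij : i < j) :
    lam n κ i + i ≤ lam n κ j + j + ∑ l, κ l := by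
  have hsum : ∑ l ∈ Finset.univ.filter (fun l : Fin (n - 1) => (l : ℕ) < n - 1 - (i : ℕ)), κ l
      ≤ ∑ l, κ l := Finset.sum_le_sum_of_subset (Finset.filter_subset _ _)
  rw [lam_eq_add_sum, lam_eq_add_sum]
  have : (i : ℕ) < j := hij
  omega

theorem lam_sub_div_le (n : ℕ) (κ : Fin (n - 1) → ℕ) {i j : Fin n} (hij : i < j) :
    ((lam n κ i : ℝ) - lam n κ j) / (((j : ℕ) : ℝ) - ((i : ℕ) : ℝ)) ≤ 1 + ∑ l, (κ l : ℝ) := by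
  have hK : (0 : ℝ) ≤ ∑ l, (κ l : ℝ) := by positivity
  have h1 : ((i : ℕ) : ℝ) + 1 ≤ ((j : ℕ) : ℝ) := by
    have h : (i : ℕ) < j := hij
    exact_mod_cast h
  have h2 : (lam n κ i : ℝ) + ((i : ℕ) : ℝ) ≤ lam n κ j + ((j : ℕ) : ℝ) + ∑ l, (κ l : ℝ) := by
    exact_mod_cast lam_le_lam_add n κ hij
  rw [div_le_iff₀ (by linarith)]
  nlinarith

theorem stmt8 (n : ℕ) (hn : 2 ≤ n) (κ : Fin (n - 1) → ℕ) :
    ∏ p ∈ Finset.univ.filter (fun p : Fin n × Fin n => p.1 < p.2),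
        (((lam n κ p.1 : ℝ) - (lam n κ p.2 : ℝ)) /
          (((p.2 : ℕ) : ℝ) - ((p.1 : ℕ) : ℝ))) ≤
      (1 + (∑ j : Fin (n - 1), (κ j : ℝ))) ^ (n ^ 2 - n) := by
  have hK : (0 : ℝ) ≤ ∑ l, (κ l : ℝ) := by positivity
  have hcard : (Finset.univ.filter (fun p : Fin n × Fin n => p.1 < p.2)).card ≤ n ^ 2 - n := by
    have hsub : Finset.univ.filter (fun p : Fin n × Fin n => p.1 < p.2) ⊆
        (Finset.univ : Finset (Fin n)).offDiag := fun p hp => by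
      simpa using (Finset.mem_filter.mp hp).2.ne
    simpa [Finset.offDiag_card, sq] using Finset.card_le_card hsub
  refine le_trans (Finset.prod_le_prod (fun p hp => ?_)
    (fun p hp => lam_sub_div_le n κ (Finset.mem_filter.mp hp).2)) ?_
  · have hlt : p.1 < p.2 := (Finset.mem_filter.mp hp).2
    exact div_nonneg (sub_nonneg.2 (Nat.cast_le.2 (lam_antitone n κ hlt.le)))
      (sub_nonneg.2 (Nat.cast_le.2 hlt.le))
  · rw [Finset.prod_const]
    exact pow_le_pow_right₀ (by linarith) hcard
end
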